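/- Let T : [0,1] → [0,1] be a piecewise expanding map preserving an ergodic measure μ with positive entropy h_μ(T) ≥ log λ > 0. Suppose for μ-a.e. x there is β(x) > 0 such that B(x, e^{-βn}) ⊆ Δ^n(x) for all n, where Δ^n(x) is the n-cylinder containing x. Then μ-almost every x is Diophantine: there exist ε(x) > 0 and ρ₀(x) > 0 such that for all ρ ≤ ρ₀ and all 0 < k ≤ ε|ln ρ|, T^{-k}B(x,ρ) ∩ B(x,ρ) = ∅. -/

import Mathlib

open MeasureTheory Filter Metric

namespace Dio

/-- push a symbol onto the past -/
def push (x : ℕ) (past : ℕ → ℕ) : ℕ → ℕ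
  | 0 => x
  | i + 1 => past i

/-- emission weights: state `0` is literal, state `k+1` copies the symbol `k+1` steps back -/
noncomputable def em (p : ℕ → ENNReal) (a : ℕ) (past : ℕ → ℕ) (x : ℕ) : ENNReal :=
  match a with
  | 0 => p x
  | k + 1 => if past k = x then 1 else 0

/-- total weight of a word -/
noncomputable def F (m : ℕ → ℕ → ENNReal) (p : ℕ → ENNReal) :
    (N : ℕ) → ℕ → (ℕ → ℕ) → (Fin N → ℕ) → ENNReal
  | 0, _, _, _ => 1
  | N + 1, b, past, w =>
      ∑' a, m b a * em p a past (w 0) * F m p N a (push (w 0) past) (Fin.tail w)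

lemma em_sum (p : ℕ → ENNReal) (hp : ∑' i, p i ≤ 1) (a : ℕ) (past : ℕ → ℕ) :
    ∑' x, em p a past x ≤ 1 := by
  cases a with
  | zero => simpa [em] using hp
  | succ k => simp [em]

lemma F_sum (m : ℕ → ℕ → ENNReal) (p : ℕ → ENNReal) (hp : ∑' i, p i ≤ 1)
    (hm : ∀ b, ∑' a, m b a ≤ 1) (N : ℕ) :
    ∀ b past, ∑' w, F m p N b past w ≤ 1 := by
  induction N with
  | zero => intro b past; simp [F]
  | succ N ih =>
    intro b past
    rw [← (Fin.consEquiv (fun _ : Fin (N + 1) => ℕ)).tsum_eq]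
    rw [ENNReal.tsum_prod']
    have h1 : ∀ x : ℕ, ∑' w : Fin N → ℕ,
        F m p (N + 1) b past (Fin.consEquiv (fun _ : Fin (N + 1) => ℕ) (x, w))
        ≤ ∑' a, m b a * em p a past x := by
      intro x
      simp only [F, Fin.consEquiv, Equiv.coe_fn_mk, Fin.cons_zero, Fin.tail_cons]
      rw [ENNReal.tsum_comm]
      refine ENNReal.tsum_le_tsum fun a => ?_
      rw [ENNReal.tsum_mul_left]
      calc _ ≤ m b a * em p a past x * 1 := by gcongr; exact ih _ _
        _ = _ := mul_one _
    calc _ ≤ ∑' x, ∑' a, m b a * em p a past x := ENNReal.tsum_le_tsum h1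
      _ = ∑' a, m b a * ∑' x, em p a past x := by
        rw [ENNReal.tsum_comm]; simp_rw [ENNReal.tsum_mul_left]
      _ ≤ ∑' a, m b a * 1 := by
        gcongr with a; exact em_sum p hp a past
      _ ≤ 1 := by simpa using hm b

/-- past of `s` at time `t` -/
def pst (s : ℕ → ℕ) (t : ℕ) (i : ℕ) : ℕ := if i < t then s (t - 1 - i) else 0

lemma push_pst (s : ℕ → ℕ) (t : ℕ) : push (s t) (pst s t) = pst s (t + 1) := by
  funext i
  cases i with
  | zero => simp [push, pst]
  | succ i =>
    simp only [push, pst, Nat.add_lt_add_iff_right]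
    congr 2; omega

/-- lower bound on the weight -/
def LB (m : ℕ → ℕ → ENNReal) (p : ℕ → ENNReal) (s : ℕ → ℕ) (N b t : ℕ) (c : ℝ) : Prop :=
  ENNReal.ofReal (Real.exp (-c)) ≤ F m p N b (pst s t) (fun j => s (t + j))

lemma LB.mono {m p s N b t c c'} (h : LB m p s N b t c) (hc : c ≤ c') : LB m p s N b t c' :=
  le_trans (by gcongr) h

lemma LB_step {m p s N b t a c u v} (hm : ENNReal.ofReal (Real.exp (-u)) ≤ m b a)
    (he : ENNReal.ofReal (Real.exp (-v)) ≤ em p a (pst s t) (s t))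
    (h : LB m p s N a (t + 1) c) : LB m p s (N + 1) b t (c + u + v) := by
  unfold LB at *
  have e1 : Fin.tail (fun j : Fin (N + 1) => s (t + j)) = fun j : Fin N => s (t + 1 + j) := by
    funext j; simp only [Fin.tail, Fin.val_succ]; congr 1; ring
  rw [F]
  refine le_trans ?_ (ENNReal.le_tsum a)
  rw [e1]
  simp only [Fin.val_zero, add_zero]
  rw [push_pst]
  have : -(c + u + v) = -u + -v + -c := by ring
  rw [this, Real.exp_add, Real.exp_add, ENNReal.ofReal_mul (by positivity),
    ENNReal.ofReal_mul (by positivity)]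
  gcongr

section
variable {m : ℕ → ℕ → ENNReal} {p : ℕ → ENNReal} {I : ℕ → ℝ} {δ E : ℝ}

lemma lit_change
    (hp : ∀ i, ENNReal.ofReal (Real.exp (-I i)) ≤ p i)
    (hm2 : ∀ b a : ℕ, ENNReal.ofReal (Real.exp (-(E + a))) ≤ m b a)
    {s : ℕ → ℕ} {N b t c} (h : LB m p s N 0 (t + 1) c) :
    LB m p s (N + 1) b t (c + E + I (s t)) := by
  simpa using LB_step (hm2 b 0) (hp (s t)) h

lemma lit_run
    (hp : ∀ i, ENNReal.ofReal (Real.exp (-I i)) ≤ p i)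
    (hm1 : ∀ b, ENNReal.ofReal (Real.exp (-δ)) ≤ m b b)
    {s : ℕ → ℕ} {N c} (r : ℕ) : ∀ t, LB m p s N 0 (t + r) c →
    LB m p s (N + r) 0 t (c + r * δ + ∑ j ∈ Finset.range r, I (s (t + j))) := by
  induction r with
  | zero => intro t h; simpa using h
  | succ r ih =>
    intro t h
    have h2 := ih (t + 1) (by rwa [add_right_comm])
    refine (LB_step (hm1 0) (hp (s t)) h2).mono ?_
    rw [Finset.sum_range_succ']
    have : ∀ j, t + 1 + j = t + (j + 1) := by intro j; ring
    simp only [this]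
    push_cast
    simp; linarith

lemma em_copy {s : ℕ → ℕ} {t k} (hk : 1 ≤ k) (hkt : k ≤ t) (h : s t = s (t - k)) :
    ENNReal.ofReal (Real.exp (-0)) ≤ em p k (pst s t) (s t) := by
  obtain ⟨k, rfl⟩ : ∃ l, k = l + 1 := ⟨k - 1, by omega⟩
  have : pst s t k = s t := by
    rw [h]; simp only [pst, if_pos (show k < t by omega)]; congr 1; omega
  simp [em, this]

lemma copy_run
    (hm1 : ∀ b, ENNReal.ofReal (Real.exp (-δ)) ≤ m b b)
    {s : ℕ → ℕ} {N c k} (hk : 1 ≤ k) (r : ℕ) : ∀ t, k ≤ t →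
    (∀ j < r, s (t + j) = s (t + j - k)) → LB m p s N k (t + r) c →
    LB m p s (N + r) k t (c + r * δ) := by
  induction r with
  | zero => intro t _ _ h; simpa using h
  | succ r ih =>
    intro t hkt hs h
    have h2 := ih (t + 1) (by omega) (fun j hj => by
      have := hs (j + 1) (by omega)
      rwa [← add_assoc, add_right_comm] at this) (by rwa [add_right_comm])
    refine (LB_step (hm1 k) (em_copy hk hkt (hs 0 (by omega))) h2).mono ?_
    push_cast
    linarith

lemma block
    (hp : ∀ i, ENNReal.ofReal (Real.exp (-I i)) ≤ p i)
    (hm1 : ∀ b, ENNReal.ofReal (Real.exp (-δ)) ≤ m b b)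
    (hm2 : ∀ b a : ℕ, ENNReal.ofReal (Real.exp (-(E + a))) ≤ m b a)
    {s : ℕ → ℕ} {N b t c k n} (hδ : 0 ≤ δ) (hk : 1 ≤ k) (hkn : k < n)
    (hs : ∀ j, j + k < n → s (t + j + k) = s (t + j))
    (h : LB m p s N k (t + n) c) :
    LB m p s (N + n) b t (c + n * δ + 2 * E + k + ∑ j ∈ Finset.range k, I (s (t + j))) := by
  obtain ⟨k, rfl⟩ : ∃ l, k = l + 1 := ⟨k - 1, by omega⟩
  obtain ⟨r, rfl⟩ : ∃ r, n = (k + 1) + (r + 1) := ⟨n - (k + 1) - 1, by omega⟩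
  have h1 := copy_run (m := m) (p := p) (s := s) hm1 hk r (t + (k + 1) + 1) (by omega)
    (fun j hj => by
      have := hs (j + 1) (by omega)
      convert this using 2 <;> omega) (by convert h using 1; ring)
  have h2 := LB_step (b := 0) (hm2 0 (k + 1)) (em_copy (p := p) (s := s) (t := t + (k + 1)) hk (by omega)
    (by have := hs 0 (by omega); convert this using 2 <;> simp)) h1
  have h3 := lit_run (m := m) (p := p) hp hm1 k (t + 1) (by convert h2 using 1; ring)
  have h4 := lit_change (b := b) hp hm2 h3
  have e : N + r + 1 + k + 1 = N + ((k + 1) + (r + 1)) := by ring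
  rw [e] at h4
  refine h4.mono ?_
  rw [Finset.sum_range_succ']
  have : ∀ j, t + 1 + j = t + (j + 1) := by intro j; ring
  simp only [this]
  push_cast
  simp
  nlinarith

/-- a periodic block of length in `[n0, M]` starts at `t` -/
def Gd (q n0 M : ℕ) (s : ℕ → ℕ) (t : ℕ) : Prop :=
  ∃ n, n0 ≤ n ∧ n ≤ M ∧ ∃ k, 1 ≤ k ∧ k * (q + 2) ≤ n ∧
    ∀ j, j + k < n → s (t + j + k) = s (t + j)

open Classical in
/-- cost function -/
noncomputable def cost (I : ℕ → ℝ) (a E L : ℝ) (q n0 M : ℕ) (s : ℕ → ℕ) (N t : ℕ) : ℝ :=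
  a * N + ∑ j ∈ Finset.range N, ((if Gd q n0 M s (t + j) then 0 else I (s (t + j)) + E)
      + max (I (s (t + j)) - L) 0)
    + ∑ j ∈ Finset.range N, (if N ≤ j + M then I (s (t + j)) + E else 0)

lemma main_lb
    (hp : ∀ i, ENNReal.ofReal (Real.exp (-I i)) ≤ p i)
    (hm1 : ∀ b, ENNReal.ofReal (Real.exp (-δ)) ≤ m b b)
    (hm2 : ∀ b a : ℕ, ENNReal.ofReal (Real.exp (-(E + a))) ≤ m b a)
    {a L : ℝ} {q n0 M : ℕ} (hδ : 0 ≤ δ) (hE : 0 ≤ E) (hI : ∀ i, 0 ≤ I i) (hL : 0 ≤ L)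
    (hn0 : 1 ≤ n0) (ha : δ + (1 + L) / (q + 2) + 2 * E / n0 ≤ a) (s : ℕ → ℕ) (N : ℕ) :
    ∀ b t, LB m p s N b t (cost I a E L q n0 M s N t) := by
  classical
  have ha0 : 0 ≤ a := le_trans (by positivity) ha
  induction N using Nat.strong_induction_on with
  | _ N ih =>
  intro b t
  rcases Nat.eq_zero_or_pos N with rfl | hN
  · simp [LB, F, cost]
  have lit : (¬ Gd q n0 M s t ∨ N ≤ M) → LB m p s N b t (cost I a E L q n0 M s N t) := by
    intro hor
    obtain ⟨N, rfl⟩ : ∃ l, N = l + 1 := ⟨N - 1, by omega⟩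
    refine (lit_change (b := b) hp hm2 (ih N (by omega) 0 (t + 1))).mono ?_
    unfold cost
    rw [Finset.sum_range_succ', Finset.sum_range_succ' _ N]
    have e1 : ∀ j, t + 1 + j = t + (j + 1) := by intro j; ring
    have e2 : ∀ j, (N + 1 ≤ j + 1 + M) = (N ≤ j + M) := by
      intro j; apply propext; omega
    simp only [e1, e2]
    have h0 := le_max_right (I (s (t + 0)) - L) 0
    have h1 := hI (s t)
    push_cast
    have : E + I (s t) ≤ (if Gd q n0 M s (t + 0) then 0 else I (s (t + 0)) + E)
        + (if N + 1 ≤ 0 + M then I (s (t + 0)) + E else 0) := by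
      simp only [add_zero, zero_add]
      rcases hor with h | h
      · rw [if_neg h]; split_ifs <;> linarith
      · rw [if_pos h]; split_ifs <;> linarith
    linarith
  by_cases hg : Gd q n0 M s t
  swap
  · exact lit (Or.inl hg)
  by_cases hNM : N ≤ M
  · exact lit (Or.inr hNM)
  obtain ⟨n, hn1, hn2, k, hk, hkn, hs⟩ := hg
  obtain ⟨R, rfl⟩ : ∃ R, N = R + n := ⟨N - n, by omega⟩
  have hkn' : k < n := by nlinarith
  refine (block (b := b) hp hm1 hm2 hδ hk hkn' hs (ih R (by omega) k (t + n))).mono ?_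
  unfold cost
  rw [add_comm R n, Finset.sum_range_add, Finset.sum_range_add _ n R]
  have e1 : ∀ j, t + n + j = t + (n + j) := by intro j; ring
  have e2 : ∀ j, (n + R ≤ n + j + M) = (R ≤ j + M) := by
    intro j; apply propext; omega
  simp only [e1, e2]
  have A1 : 0 ≤ ∑ j ∈ Finset.range n, (if n + R ≤ j + M then I (s (t + j)) + E else 0) := by
    refine Finset.sum_nonneg fun j _ => ?_
    have := hI (s (t + j))
    split_ifs <;> linarith
  have A2 : ∑ j ∈ Finset.range k, I (s (t + j)) - k * L ≤
      ∑ j ∈ Finset.range n, ((if Gd q n0 M s (t + j) then 0 else I (s (t + j)) + E)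
      + max (I (s (t + j)) - L) 0) := by
    calc _ = ∑ j ∈ Finset.range k, (I (s (t + j)) - L) := by
            simp [Finset.sum_sub_distrib]
      _ ≤ ∑ j ∈ Finset.range k, ((if Gd q n0 M s (t + j) then 0 else I (s (t + j)) + E)
          + max (I (s (t + j)) - L) 0) := by
            refine Finset.sum_le_sum fun j _ => ?_
            have := hI (s (t + j))
            have := le_max_left (I (s (t + j)) - L) 0
            split_ifs <;> linarith
      _ ≤ _ := by
            refine Finset.sum_le_sum_of_subset_of_nonneg ?_ fun j _ _ => ?_
            · intro j; simp; omega
            · have := hI (s (t + j))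
              have := le_max_right (I (s (t + j)) - L) 0
              split_ifs <;> linarith
  have A3 : n * δ + 2 * E + k + k * L ≤ a * n := by
    have h1 : (k : ℝ) ≤ n / (q + 2) := by
      rw [le_div_iff₀ (by positivity)]; exact_mod_cast hkn
    have h2 : 2 * E ≤ 2 * E / n0 * n := by
      have h0 : (0 : ℝ) < n0 := by exact_mod_cast hn0
      rw [div_mul_eq_mul_div, le_div_iff₀ h0]
      have : (n0 : ℝ) ≤ n := by exact_mod_cast hn1
      gcongr
    have h3 : (k : ℝ) * (1 + L) ≤ n / (q + 2) * (1 + L) := by gcongr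
    have h4 : (δ + (1 + L) / (q + 2) + 2 * E / n0) * n ≤ a * n := by gcongr
    have h5 : (n : ℝ) / (q + 2) * (1 + L) = (1 + L) / (q + 2) * n := by ring
    nlinarith
  push_cast
  linarith
end

/-- transition weights exist -/
lemma exists_m (δ : ℝ) (hδ : 0 < δ) : ∃ (E : ℝ) (m : ℕ → ℕ → ENNReal), 0 ≤ E ∧
    (∀ b, ∑' a, m b a ≤ 1) ∧ (∀ b, ENNReal.ofReal (Real.exp (-δ)) ≤ m b b) ∧
    (∀ b a : ℕ, ENNReal.ofReal (Real.exp (-(E + a))) ≤ m b a) := by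
  have h1 : Real.exp (-δ) < 1 := by rw [Real.exp_lt_one_iff]; linarith
  have h2 := Real.exp_pos (-δ)
  set η := 1 - Real.exp (-δ) with hη
  have hη0 : 0 < η := by linarith
  have hl : Real.log η ≤ 0 := Real.log_nonpos hη0.le (by linarith)
  refine ⟨-Real.log η + 1, fun b a => (if a = b then ENNReal.ofReal (Real.exp (-δ)) else 0)
    + ENNReal.ofReal η * (2⁻¹) ^ (a + 1), by linarith, ?_, ?_, ?_⟩
  · intro b
    rw [ENNReal.tsum_add, tsum_ite_eq, ENNReal.tsum_mul_left, ENNReal.tsum_geometric_add_one]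
    have : (2⁻¹ : ENNReal) * (1 - 2⁻¹)⁻¹ = 1 := by
      rw [ENNReal.one_sub_inv_two, inv_inv]; exact ENNReal.inv_mul_cancel (by simp) (by simp)
    rw [this, mul_one, ← ENNReal.ofReal_add h2.le hη0.le, hη]
    simp
  · intro b; simp
  · intro b a
    refine le_trans ?_ le_add_self
    have : (2⁻¹ : ENNReal) = ENNReal.ofReal (2⁻¹) := by
      rw [ENNReal.ofReal_inv_of_pos (by norm_num)]; simp
    rw [this, ← ENNReal.ofReal_pow (by norm_num), ← ENNReal.ofReal_mul hη0.le]
    apply ENNReal.ofReal_le_ofReal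
    have : -(-Real.log η + 1 + (a : ℝ)) = Real.log η + ((a + 1 : ℕ) : ℝ) * (-1) := by
      push_cast; ring
    rw [this, Real.exp_add, Real.exp_log hη0, Real.exp_nat_mul]
    gcongr
    rw [Real.exp_neg]
    gcongr
    have := Real.add_one_le_exp 1
    linarith


section
variable {X : Type*} [MeasurableSpace X] (μ : Measure X) [IsProbabilityMeasure μ]

lemma ent_eq {ι : Type*} [Countable ι] [MeasurableSpace ι] [MeasurableSingletonClass ι]
    (Z : X → ι) (hZ : Measurable Z) (g : ι → ENNReal) :
    ∫⁻ x, g (Z x) ∂μ = ∑' w, g w * μ (Z ⁻¹' {w}) := by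
  rw [← lintegral_map (f := g) (Measurable.of_discrete) hZ, lintegral_countable']
  congr 1; funext w
  rw [Measure.map_apply hZ (measurableSet_singleton w)]

lemma ent_eq2 {ι : Type*} [Countable ι] [MeasurableSpace ι] [MeasurableSingletonClass ι]
    (Z : X → ι) (hZ : Measurable Z) :
    ∑' w, ENNReal.ofReal (Real.negMulLog (μ (Z ⁻¹' {w})).toReal) =
    ∫⁻ x, ENNReal.ofReal (-Real.log (μ (Z ⁻¹' {Z x})).toReal) ∂μ := by
  rw [ent_eq μ Z hZ (fun w => ENNReal.ofReal (-Real.log (μ (Z ⁻¹' {w})).toReal))]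
  congr 1; funext w
  have : μ (Z ⁻¹' {w}) = ENNReal.ofReal (μ (Z ⁻¹' {w})).toReal :=
    (ENNReal.ofReal_toReal (measure_ne_top _ _)).symm
  conv_rhs => rw [mul_comm]; lhs; rw [this]
  rw [← ENNReal.ofReal_mul (by positivity)]
  simp [Real.negMulLog]

lemma gibbs {ι : Type*} [Countable ι] [MeasurableSpace ι] [MeasurableSingletonClass ι]
    (Z : X → ι) (hZ : Measurable Z) (Q : ι → ENNReal) (hQ : ∑' w, Q w ≤ 1) (c : X → ℝ)
    (hc : ∀ x, ENNReal.ofReal (Real.exp (-c x)) ≤ Q (Z x)) :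
    ∑' w, ENNReal.ofReal (Real.negMulLog (μ (Z ⁻¹' {w})).toReal) ≤
      ∫⁻ x, ENNReal.ofReal (c x) ∂μ + 1 := by
  rw [ent_eq2 μ Z hZ]
  have h1 : ∀ x, ENNReal.ofReal (-Real.log (μ (Z ⁻¹' {Z x})).toReal) ≤
      ENNReal.ofReal (c x) + Q (Z x) / μ (Z ⁻¹' {Z x}) := by
    intro x
    set u := μ (Z ⁻¹' {Z x}) with hu
    by_cases h0 : u = 0
    · simp [h0]
    have hu1 : u ≠ ⊤ := measure_ne_top _ _
    have hpos : 0 < u.toReal := ENNReal.toReal_pos h0 hu1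
    have h2 : -Real.log u.toReal ≤ c x + Real.exp (-c x) / u.toReal := by
      have := Real.log_le_sub_one_of_pos (show 0 < Real.exp (-c x) / u.toReal by positivity)
      rw [Real.log_div (Real.exp_pos _).ne' hpos.ne', Real.log_exp] at this
      linarith
    refine (ENNReal.ofReal_le_ofReal h2).trans (ENNReal.ofReal_add_le.trans ?_)
    gcongr
    rw [ENNReal.ofReal_div_of_pos hpos, ENNReal.ofReal_toReal hu1]
    gcongr
    exact hc x
  refine (lintegral_mono h1).trans ?_
  have hme : Measurable (fun x => Q (Z x) / μ (Z ⁻¹' {Z x})) :=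
    (Measurable.of_discrete (f := fun w => Q w / μ (Z ⁻¹' {w}))).comp hZ
  rw [lintegral_add_right _ hme]
  gcongr
  rw [ent_eq μ Z hZ (fun w => Q w / μ (Z ⁻¹' {w}))]
  refine le_trans (ENNReal.tsum_le_tsum fun w => ?_) hQ
  rw [mul_comm]; exact ENNReal.mul_div_le

lemma ae_pos {ι : Type*} [Countable ι] (Z : X → ι) : ∀ᵐ x ∂μ, μ (Z ⁻¹' {Z x}) ≠ 0 := by
  have : ∀ w : ι, ∀ᵐ x ∂μ, Z x = w → μ (Z ⁻¹' {w}) ≠ 0 := by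
    intro w
    by_cases h : μ (Z ⁻¹' {w}) = 0
    · have : ∀ᵐ x ∂μ, x ∉ Z ⁻¹' {w} := measure_eq_zero_iff_ae_notMem.1 h
      filter_upwards [this] with x hx hx'
      exact absurd hx' hx
    · exact Eventually.of_forall fun x _ => h
  filter_upwards [ae_all_iff.2 this] with x hx
  exact hx _ rfl

lemma ent_mono {ι κ : Type*} [Countable ι] [MeasurableSpace ι] [MeasurableSingletonClass ι]
    [Countable κ] [MeasurableSpace κ] [MeasurableSingletonClass κ]
    (Z : X → ι) (hZ : Measurable Z) (W : X → κ) (hW : Measurable W) (f : ι → κ)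
    (hf : ∀ x, W x = f (Z x)) :
    ∑' w, ENNReal.ofReal (Real.negMulLog (μ (W ⁻¹' {w})).toReal) ≤
    ∑' w, ENNReal.ofReal (Real.negMulLog (μ (Z ⁻¹' {w})).toReal) := by
  rw [ent_eq2 μ Z hZ, ent_eq2 μ W hW]
  refine lintegral_mono_ae ?_
  filter_upwards [ae_pos μ Z] with x hx
  have h1 : μ (Z ⁻¹' {Z x}) ≤ μ (W ⁻¹' {W x}) := by
    refine measure_mono fun y hy => ?_
    have hy' : Z y = Z x := hy
    show W y = W x
    rw [hf, hf, hy']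
  have h2 := ENNReal.toReal_pos hx (measure_ne_top _ _)
  have h3 := ENNReal.toReal_mono (measure_ne_top _ _) h1
  have := Real.log_le_log h2 h3
  apply ENNReal.ofReal_le_ofReal
  linarith

lemma exists_I (sym : X → ℕ) (hsym : Measurable sym)
    (hH : ∑' i, ENNReal.ofReal (Real.negMulLog (μ (sym ⁻¹' {i})).toReal) ≠ ⊤) :
    ∃ I : ℕ → ℝ, (∀ i, 0 ≤ I i) ∧ ∑' i, ENNReal.ofReal (Real.exp (-I i)) ≤ 1 ∧
      ∫⁻ x, ENNReal.ofReal (I (sym x)) ∂μ ≠ ⊤ := by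
  set u : ℕ → ℝ := fun i => (μ (sym ⁻¹' {i})).toReal with hu
  have hu0 : ∀ i, 0 ≤ u i := fun i => ENNReal.toReal_nonneg
  have hu1 : ∀ i, u i ≤ 1 := fun i => by
    have := ENNReal.toReal_mono ENNReal.one_ne_top (prob_le_one (μ := μ) (s := sym ⁻¹' {i}))
    simpa using this
  have hv : ∀ i, 0 < (u i + (2⁻¹ : ℝ) ^ (i + 1)) / 2 := fun i => by
    have := hu0 i; positivity
  have hsum : ∑' i, μ (sym ⁻¹' {i}) = 1 := by
    have := ent_eq μ sym hsym (fun _ => 1)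
    simpa using this.symm
  refine ⟨fun i => -Real.log ((u i + (2⁻¹ : ℝ) ^ (i + 1)) / 2), ?_, ?_, ?_⟩
  · intro i
    have : Real.log ((u i + (2⁻¹ : ℝ) ^ (i + 1)) / 2) ≤ 0 := by
      apply Real.log_nonpos (hv i).le
      have h1 : (2⁻¹ : ℝ) ^ (i + 1) ≤ 1 := pow_le_one₀ (by norm_num) (by norm_num)
      linarith [hu1 i]
    linarith
  · have : ∀ i, ENNReal.ofReal (Real.exp (-(-Real.log ((u i + (2⁻¹ : ℝ) ^ (i + 1)) / 2)))) =
        (μ (sym ⁻¹' {i}) + (2⁻¹) ^ (i + 1)) * 2⁻¹ := by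
      intro i
      rw [neg_neg, Real.exp_log (hv i), div_eq_mul_inv, ENNReal.ofReal_mul (by have := hu0 i; positivity),
        ENNReal.ofReal_add (hu0 i) (by positivity), ENNReal.ofReal_pow (by norm_num),
        ENNReal.ofReal_toReal (measure_ne_top _ _), ENNReal.ofReal_inv_of_pos (by norm_num)]
      simp
    simp_rw [this]
    rw [ENNReal.tsum_mul_right, ENNReal.tsum_add, hsum, ENNReal.tsum_geometric_add_one,
      ENNReal.one_sub_inv_two, inv_inv, ENNReal.inv_mul_cancel (by simp) (by simp), one_add_one_eq_two,
      ENNReal.mul_inv_cancel (by simp) (by simp)]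
  · rw [ent_eq μ sym hsym (fun i => ENNReal.ofReal (-Real.log ((u i + (2⁻¹ : ℝ) ^ (i + 1)) / 2)))]
    have : ∀ i, ENNReal.ofReal (-Real.log ((u i + (2⁻¹ : ℝ) ^ (i + 1)) / 2)) * μ (sym ⁻¹' {i}) ≤
        ENNReal.ofReal (Real.negMulLog (u i)) + ENNReal.ofReal (Real.log 2) * μ (sym ⁻¹' {i}) := by
      intro i
      have e : μ (sym ⁻¹' {i}) = ENNReal.ofReal (u i) :=
        (ENNReal.ofReal_toReal (measure_ne_top _ _)).symm
      rw [e, ← ENNReal.ofReal_mul' (hu0 i), ← ENNReal.ofReal_mul' (hu0 i)]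
      refine le_trans (ENNReal.ofReal_le_ofReal ?_) ENNReal.ofReal_add_le
      rcases (hu0 i).eq_or_lt with h | h
      · simp [← h]
      have h1 : Real.log (u i / 2) ≤ Real.log ((u i + (2⁻¹ : ℝ) ^ (i + 1)) / 2) := by
        apply Real.log_le_log (by positivity)
        gcongr
        have : (0 : ℝ) ≤ (2⁻¹ : ℝ) ^ (i + 1) := by positivity
        linarith
      rw [Real.log_div h.ne' (by norm_num)] at h1
      rw [Real.negMulLog]
      nlinarith
    refine ne_top_of_le_ne_top ?_ (ENNReal.tsum_le_tsum this)
    rw [ENNReal.tsum_add, ENNReal.tsum_mul_left, hsum]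
    exact ENNReal.add_ne_top.2 ⟨hH, by simp⟩

/-- points with a periodic initial block of length in `[n0, M]` -/
def GS (T : X → X) (sym : X → ℕ) (q n0 M : ℕ) : Set X :=
  {x | Gd q n0 M (fun t => sym (T^[t] x)) 0}

lemma GS_iff (T : X → X) (sym : X → ℕ) (q n0 M : ℕ) (x : X) (t : ℕ) :
    T^[t] x ∈ GS T sym q n0 M ↔ Gd q n0 M (fun t => sym (T^[t] x)) t := by
  simp only [GS, Gd, Set.mem_ofPred_eq, ← Function.iterate_add_apply]
  have e1 : ∀ j k, 0 + j + k + t = t + j + k := by intros; omega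
  have e2 : ∀ j, 0 + j + t = t + j := by intros; omega
  simp only [e1, e2]

lemma GS_meas {T : X → X} (hT : Measurable T) {sym : X → ℕ} (hsym : Measurable sym) (q n0 M : ℕ) :
    MeasurableSet (GS T sym q n0 M) := by
  have h : ∀ a b : ℕ, MeasurableSet {x | sym (T^[a] x) = sym (T^[b] x)} := fun a b =>
    measurableSet_eq_fun (hsym.comp (hT.iterate a)) (hsym.comp (hT.iterate b))
  simp only [GS, Gd]
  refine measurableSet_setOfPred.2 ?_
  refine Measurable.exists fun n => ?_
  refine Measurable.and (by fun_prop) (Measurable.and (by fun_prop) ?_)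
  refine Measurable.exists fun k => ?_
  refine Measurable.and (by fun_prop) (Measurable.and (by fun_prop) ?_)
  refine Measurable.forall fun j => ?_
  refine Measurable.imp (by fun_prop) ?_
  exact (measurableSet_setOfPred).1 (h _ _)

lemma core (T : X → X) (hT : MeasurePreserving T μ μ) (sym : X → ℕ) (hsym : Measurable sym)
    (hH : ∑' i, ENNReal.ofReal (Real.negMulLog (μ (sym ⁻¹' {i})).toReal) ≠ ⊤)
    (hA : ∀ᵐ x ∂μ, ∀ q n0 : ℕ, ∃ M, x ∈ GS T sym q n0 M) (κ : ℝ) (hκ : 0 < κ) :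
    ∃ C : ℝ, 0 ≤ C ∧ ∀ N : ℕ, ∑' w : Fin N → ℕ, ENNReal.ofReal (Real.negMulLog
      (μ ((fun x => fun j : Fin N => sym (T^[j] x)) ⁻¹' {w})).toReal) ≤
        ENNReal.ofReal (κ * N + C) := by
  classical
  obtain ⟨I, hI0, hIsum, hIint⟩ := exists_I μ sym hsym hH
  obtain ⟨E, m, hE, hmsum, hm1, hm2⟩ := exists_m (κ / 8) (by positivity)
  have hε : (0 : ENNReal) < ENNReal.ofReal (κ / 8) := by simpa using by positivity
  -- choose L
  obtain ⟨L, hL⟩ : ∃ L : ℕ, ∫⁻ x, ENNReal.ofReal (I (sym x) - L) ∂μ < ENNReal.ofReal (κ / 8) := by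
    have := tendsto_lintegral_of_dominated_convergence (μ := μ)
      (F := fun (L : ℕ) x => ENNReal.ofReal (I (sym x) - L)) (f := fun _ => 0)
      (fun x => ENNReal.ofReal (I (sym x)))
      (fun L => (Measurable.of_discrete (f := fun i => ENNReal.ofReal (I i - L))).comp hsym)
      (fun L => Eventually.of_forall fun x => ENNReal.ofReal_le_ofReal (by simp)) hIint
      (Eventually.of_forall fun x => by
        obtain ⟨L0, hL0⟩ := exists_nat_ge (I (sym x))
        refine tendsto_const_nhds.congr' ?_
        filter_upwards [eventually_ge_atTop L0] with L hL
        have : (L0 : ℝ) ≤ L := by exact_mod_cast hL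
        exact (ENNReal.ofReal_of_nonpos (by linarith)).symm)
    simp only [lintegral_zero] at this
    exact ((tendsto_order.1 this).2 _ hε).exists
  obtain ⟨q, hq⟩ := exists_nat_ge ((1 + (L : ℝ)) / (κ / 8))
  obtain ⟨n1, hn1⟩ := exists_nat_ge (2 * E / (κ / 8))
  set n0 := n1 + 1 with hn0
  set G : X → ENNReal := fun x => ENNReal.ofReal (I (sym x) + E) with hG
  have hGm : Measurable G :=
    (Measurable.of_discrete (f := fun i => ENNReal.ofReal (I i + E))).comp hsym
  have hGint : ∫⁻ x, G x ∂μ ≠ ⊤ := by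
    refine ne_top_of_le_ne_top ?_ (lintegral_mono (fun x => ENNReal.ofReal_add_le))
    rw [lintegral_add_right _ measurable_const]
    exact ENNReal.add_ne_top.2 ⟨hIint, by simp⟩
  have hmeas : ∀ M, MeasurableSet (GS T sym q n0 M) := GS_meas hT.measurable hsym q n0
  obtain ⟨M, hM⟩ : ∃ M : ℕ, ∫⁻ x in (GS T sym q n0 M)ᶜ, G x ∂μ < ENNReal.ofReal (κ / 8) := by
    have hanti : Antitone (fun M => (GS T sym q n0 M)ᶜ) := by
      intro M M' h
      apply Set.compl_subset_compl.2
      rintro x ⟨n, h1, h2, h3⟩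
      exact ⟨n, h1, h2.trans h, h3⟩
    have h0 : Tendsto (μ ∘ fun M => (GS T sym q n0 M)ᶜ) atTop (nhds 0) := by
      have := tendsto_measure_iInter_atTop (μ := μ) (s := fun M => (GS T sym q n0 M)ᶜ)
        (fun M => (hmeas M).compl.nullMeasurableSet) hanti ⟨0, measure_ne_top _ _⟩
      have hz : μ (⋂ M, (GS T sym q n0 M)ᶜ) = 0 := by
        rw [measure_eq_zero_iff_ae_notMem]
        filter_upwards [hA] with x hx hx'
        obtain ⟨M, hM⟩ := hx q n0
        exact Set.mem_iInter.1 hx' M hM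
      rwa [hz] at this
    exact ((tendsto_order.1 (tendsto_setLIntegral_zero hGint h0)).2 _ hε).exists
  have ha : κ / 8 + (1 + (L : ℝ)) / (q + 2) + 2 * E / n0 ≤ 3 * (κ / 8) := by
    have h1 : (1 + (L : ℝ)) / (q + 2) ≤ κ / 8 := by
      rw [div_le_iff₀ (by positivity)]
      rw [div_le_iff₀ (by positivity)] at hq
      nlinarith
    have h2 : 2 * E / n0 ≤ κ / 8 := by
      rw [div_le_iff₀ (by rw [hn0]; positivity)]
      rw [div_le_iff₀ (by positivity)] at hn1
      rw [hn0]; push_cast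
      nlinarith
    linarith
  refine ⟨(M * ∫⁻ x, G x ∂μ).toReal + 1, by positivity, fun N => ?_⟩
  set c : X → ℝ := fun x => cost I (3 * (κ / 8)) E L q n0 M (fun t => sym (T^[t] x)) N 0 with hc
  have hZ : Measurable (fun x => fun j : Fin N => sym (T^[j] x)) :=
    measurable_pi_lambda _ fun j => hsym.comp (hT.measurable.iterate j)
  have key := gibbs μ (fun x => fun j : Fin N => sym (T^[j] x)) hZ
    (F m (fun i => ENNReal.ofReal (Real.exp (-I i))) N 0 (pst (fun _ => 0) 0))
    (F_sum m _ hIsum hmsum N 0 _) c (fun x => by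
      have := main_lb (p := fun i => ENNReal.ofReal (Real.exp (-I i))) (fun i => le_rfl) hm1 hm2
        (M := M) (by positivity) hE hI0 (Nat.cast_nonneg L) (show 1 ≤ n0 by omega) ha
        (fun t => sym (T^[t] x)) N 0 0
      unfold LB at this
      simp only [zero_add] at this
      convert this using 2
      funext i; simp [pst])
  refine key.trans ?_
  set g : X → ENNReal := fun x => (GS T sym q n0 M)ᶜ.indicator G x + ENNReal.ofReal (I (sym x) - L)
    with hg
  have hLm : Measurable fun x => ENNReal.ofReal (I (sym x) - L) :=
    (Measurable.of_discrete (f := fun i => ENNReal.ofReal (I i - L))).comp hsym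
  have hgm : Measurable g := (hGm.indicator (hmeas M).compl).add hLm
  have hgint : ∫⁻ x, g x ∂μ ≤ ENNReal.ofReal (2 * (κ / 8)) := by
    rw [hg, lintegral_add_right _ hLm, lintegral_indicator (hmeas M).compl, two_mul,
      ENNReal.ofReal_add (by positivity) (by positivity)]
    exact add_le_add hM.le hL.le
  have hcb : ∀ x, ENNReal.ofReal (c x) ≤ ENNReal.ofReal (3 * (κ / 8) * N) +
      ∑ j ∈ Finset.range N, g (T^[j] x) +
      ∑ j ∈ Finset.range N, (if N ≤ j + M then G (T^[j] x) else 0) := by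
    intro x
    rw [hc]
    simp only [cost, zero_add]
    refine ENNReal.ofReal_add_le.trans (add_le_add (ENNReal.ofReal_add_le.trans
      (add_le_add le_rfl ?_)) ?_)
    · refine le_trans ?_ (Finset.sum_le_sum (f := fun j => ENNReal.ofReal
        ((if Gd q n0 M (fun t => sym (T^[t] x)) j then 0 else I (sym (T^[j] x)) + E)
          + max (I (sym (T^[j] x)) - L) 0)) fun j _ => ?_)
      · rw [ENNReal.ofReal_sum_of_nonneg]
        intro j _
        have := hI0 (sym (T^[j] x))
        have := le_max_right (I (sym (T^[j] x)) - L) 0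
        split_ifs <;> linarith
      · refine ENNReal.ofReal_add_le.trans (add_le_add ?_ ?_)
        · by_cases h : Gd q n0 M (fun t => sym (T^[t] x)) j
          · simp [h]
          · rw [if_neg h, Set.indicator_of_mem]
            exact fun h' => h ((GS_iff T sym q n0 M x j).1 h')
        · simp
    · rw [ENNReal.ofReal_sum_of_nonneg]
      · refine Finset.sum_le_sum fun j _ => ?_
        split_ifs
        · exact le_rfl
        · simp
      · intro j _
        have := hI0 (sym (T^[j] x))
        split_ifs <;> linarith
  have hcint : ∫⁻ x, ENNReal.ofReal (c x) ∂μ ≤ ENNReal.ofReal (3 * (κ / 8) * N) +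
      N * ENNReal.ofReal (2 * (κ / 8)) + M * ∫⁻ x, G x ∂μ := by
    refine (lintegral_mono hcb).trans ?_
    have hj : ∀ j : ℕ, Measurable fun x => g (T^[j] x) := fun j =>
      hgm.comp (hT.measurable.iterate j)
    have hj' : ∀ j : ℕ, Measurable fun x => (if N ≤ j + M then G (T^[j] x) else 0) := fun j => by
      split_ifs
      · exact hGm.comp (hT.measurable.iterate j)
      · exact measurable_const
    rw [lintegral_add_right _ (Finset.measurable_fun_sum _ fun j _ => hj' j),
      lintegral_add_right _ (Finset.measurable_fun_sum _ fun j _ => hj j),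
      lintegral_finsetSum _ (fun j _ => hj j), lintegral_finsetSum _ (fun j _ => hj' j)]
    refine add_le_add (add_le_add (by simp) ?_) ?_
    · calc _ = ∑ j ∈ Finset.range N, ∫⁻ x, g x ∂μ :=
            Finset.sum_congr rfl fun j _ => (hT.iterate j).lintegral_comp hgm
        _ ≤ _ := by
            rw [Finset.sum_const, Finset.card_range, nsmul_eq_mul]
            gcongr
    · calc _ = ∑ j ∈ Finset.range N, (if N ≤ j + M then ∫⁻ x, G x ∂μ else 0) := by
            refine Finset.sum_congr rfl fun j _ => ?_
            split_ifs
            · exact (hT.iterate j).lintegral_comp hGm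
            · simp
        _ ≤ _ := by
            rw [← Finset.sum_filter, Finset.sum_const, nsmul_eq_mul]
            gcongr
            calc _ ≤ (Finset.Ico (N - M) N).card := by
                  apply Finset.card_le_card
                  intro j; simp; omega
              _ ≤ M := by simp; omega
  have hMG : (M : ENNReal) * ∫⁻ x, G x ∂μ ≠ ⊤ := ENNReal.mul_ne_top (by simp) hGint
  calc _ ≤ ENNReal.ofReal (3 * (κ / 8) * N) +
      N * ENNReal.ofReal (2 * (κ / 8)) + M * ∫⁻ x, G x ∂μ + 1 := by gcongr
    _ = ENNReal.ofReal (3 * (κ / 8) * N + N * (2 * (κ / 8)) + (M * ∫⁻ x, G x ∂μ).toReal + 1) := by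
      rw [ENNReal.ofReal_add (by positivity) (by positivity), ENNReal.ofReal_add (by positivity) (by positivity),
        ENNReal.ofReal_add (by positivity) (by positivity), ENNReal.ofReal_toReal hMG,
        ENNReal.ofReal_mul (p := (N : ℝ)) (by positivity)]
      simp
    _ ≤ _ := by
      apply ENNReal.ofReal_le_ofReal
      have : 0 ≤ κ * N := by positivity
      nlinarith

end
end Dio

/-- A.e. point is Diophantine: if `T` preserves an ergodic measure with positive entropy
(for a countable partition `P`), and a.e. `x` has balls `B(x, e^{-βn})` contained in the
`n`-cylinders `Δⁿ(x)`, then for a.e. `x` there are `ε, ρ₀ > 0` such that for all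
`ρ ≤ ρ₀` and `0 < k ≤ ε|ln ρ|`, `T^{-k}B(x,ρ) ∩ B(x,ρ) = ∅`. -/
theorem stmt11 {X : Type*} [MetricSpace X] [MeasurableSpace X] [BorelSpace X]
    (μ : Measure X) [IsProbabilityMeasure μ]
    (T : X → X) (hT : MeasurePreserving T μ μ) (herg : Ergodic T μ)
    (P : ℕ → Set X) (hPmeas : ∀ i, MeasurableSet (P i))
    (hPdisj : Pairwise (Function.onFun Disjoint P))
    (hPcover : ⋃ i, P i = Set.univ)
    (lam h : ℝ) (hlam : 1 < lam) (hh : Real.log lam ≤ h)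
    (hentropy : Tendsto
      (fun n : ℕ =>
        (∑' w : Fin n → ℕ,
          Real.negMulLog (μ (⋂ j : Fin n, T^[j.val] ⁻¹' P (w j))).toReal) / n)
      atTop (nhds h))
    (hball : ∀ᵐ x ∂μ, ∃ β > (0 : ℝ), ∀ n : ℕ,
      ball x (Real.exp (-β * n)) ⊆
        {y | ∀ j < n, ∀ i, T^[j] x ∈ P i → T^[j] y ∈ P i}) :
    ∀ᵐ x ∂μ, ∃ ε > (0 : ℝ), ∃ ρ₀ > (0 : ℝ), ∀ ρ : ℝ, 0 < ρ → ρ ≤ ρ₀ →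
      ∀ k : ℕ, 0 < k → (k : ℝ) ≤ ε * |Real.log ρ| →
        T^[k] ⁻¹' ball x ρ ∩ ball x ρ = ∅ := by
  classical
  have hex : ∀ x, ∃ i, x ∈ P i := fun x => Set.mem_iUnion.1 (hPcover ▸ Set.mem_univ x)
  choose sym hsymP using hex
  have hiff : ∀ x i, x ∈ P i ↔ sym x = i := by
    intro x i
    constructor
    · intro hx
      by_contra hne
      exact Set.disjoint_left.1 (hPdisj hne) (hsymP x) hx
    · rintro rfl; exact hsymP x
  have hpre : ∀ i, sym ⁻¹' {i} = P i := by
    intro i; ext x; simp [hiff]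
  have hsym : Measurable sym := measurable_to_countable' fun i => by
    rw [hpre]; exact hPmeas i
  have hcyl : ∀ (n : ℕ) (w : Fin n → ℕ), (⋂ j : Fin n, T^[j.val] ⁻¹' P (w j)) =
      (fun x => fun j : Fin n => sym (T^[j] x)) ⁻¹' {w} := by
    intro n w
    ext x
    simp [hiff, funext_iff]
  have hZ : ∀ n : ℕ, Measurable (fun x => fun j : Fin n => sym (T^[j] x)) := fun n =>
    measurable_pi_lambda _ fun j => hsym.comp (hT.measurable.iterate j)
  have hlog : 0 < Real.log lam := Real.log_pos hlam
  simp only [hcyl] at hentropy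
  have hnn : ∀ (n : ℕ) (w : Fin n → ℕ), 0 ≤ Real.negMulLog
      (μ ((fun x => fun j : Fin n => sym (T^[j] x)) ⁻¹' {w})).toReal := by
    intro n w
    apply Real.negMulLog_nonneg ENNReal.toReal_nonneg
    have := ENNReal.toReal_mono ENNReal.one_ne_top (prob_le_one (μ := μ)
      (s := (fun x => fun j : Fin n => sym (T^[j] x)) ⁻¹' {w}))
    simpa using this
  -- the partition has finite entropy
  have hH : ∑' i, ENNReal.ofReal (Real.negMulLog (μ (sym ⁻¹' {i})).toReal) ≠ ⊤ := by
    have hpos : ∀ᶠ n : ℕ in atTop, 0 < (∑' w : Fin n → ℕ, Real.negMulLog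
      (μ ((fun x => fun j : Fin n => sym (T^[j] x)) ⁻¹' {w})).toReal) / n :=
      (tendsto_order.1 hentropy).1 0 (by linarith)
    obtain ⟨n, hn, hn1⟩ := (hpos.and (eventually_ge_atTop 1)).exists
    have hs : Summable (fun w : Fin n → ℕ => Real.negMulLog
      (μ ((fun x => fun j : Fin n => sym (T^[j] x)) ⁻¹' {w})).toReal) := by
      by_contra hns
      rw [tsum_eq_zero_of_not_summable hns] at hn
      simp at hn
    refine ne_top_of_le_ne_top hs.tsum_ofReal_ne_top
      (Dio.ent_mono μ _ (hZ n) sym hsym (fun w => w ⟨0, hn1⟩) (fun x => by simp))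
  -- the bad set
  set A : Set X := {x | ∀ q n0 : ℕ, ∃ M, x ∈ Dio.GS T sym q n0 M} with hA
  have hAeq : A = ⋂ q : ℕ, ⋂ n0 : ℕ, ⋃ M : ℕ, Dio.GS T sym q n0 M := by
    ext x; simp [hA]
  have hAmeas : MeasurableSet A := by
    rw [hAeq]
    exact MeasurableSet.iInter fun q => MeasurableSet.iInter fun n0 => MeasurableSet.iUnion fun M =>
      Dio.GS_meas hT.measurable hsym q n0 M
  have hAsub : A ⊆ T ⁻¹' A := by
    intro x hx q n0
    obtain ⟨M, n, h1, h2, k, hk, hkn, hs⟩ := hx (q + 1) (n0 + 1)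
    refine ⟨M, ?_⟩
    have := Dio.GS_iff T sym q n0 M x 1
    rw [Function.iterate_one] at this
    refine this.2 ⟨n - 1, by omega, by omega, k, hk, ?_, fun j hj => ?_⟩
    · have : k * (q + 1 + 2) = k * (q + 2) + k := by ring
      omega
    · have := hs (1 + j) (by omega)
      simpa using this
  have hA0 : μ A = 0 := by
    rcases herg.ae_empty_or_univ_of_ae_le_preimage hAmeas.nullMeasurableSet
      hAsub.eventuallyLE with h0 | h1
    · exact ae_eq_empty.1 h0
    exfalso
    have hae : ∀ᵐ x ∂μ, ∀ q n0 : ℕ, ∃ M, x ∈ Dio.GS T sym q n0 M := by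
      filter_upwards [h1] with x hx
      have : x ∈ A := by
        have : A x = Set.univ x := hx
        exact this.mpr trivial
      exact this
    obtain ⟨C, hC0, hC⟩ := Dio.core μ T hT sym hsym hH hae (Real.log lam / 2) (by positivity)
    have hle : ∀ᶠ n : ℕ in atTop, (∑' w : Fin n → ℕ, Real.negMulLog
      (μ ((fun x => fun j : Fin n => sym (T^[j] x)) ⁻¹' {w})).toReal) / n ≤
        Real.log lam / 2 + C / n := by
      filter_upwards [eventually_ge_atTop 1] with n hn
      have hn' : (0 : ℝ) < n := by exact_mod_cast hn
      have hb : 0 ≤ Real.log lam / 2 * n + C := by positivity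
      have : (∑' w : Fin n → ℕ, Real.negMulLog
          (μ ((fun x => fun j : Fin n => sym (T^[j] x)) ⁻¹' {w})).toReal) ≤
          Real.log lam / 2 * n + C := by
        by_cases hs : Summable (fun w : Fin n → ℕ => Real.negMulLog
          (μ ((fun x => fun j : Fin n => sym (T^[j] x)) ⁻¹' {w})).toReal)
        · have h2 := hC n
          rw [← ENNReal.ofReal_tsum_of_nonneg (hnn n) hs] at h2
          exact (ENNReal.ofReal_le_ofReal_iff hb).1 h2
        · rw [tsum_eq_zero_of_not_summable hs]; exact hb
      rw [div_le_iff₀ hn']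
      have e : (Real.log lam / 2 + C / n) * n = Real.log lam / 2 * n + C := by field_simp
      rw [e]; exact this
    have hlim : Tendsto (fun n : ℕ => Real.log lam / 2 + C / n) atTop
        (nhds (Real.log lam / 2 + 0)) :=
      tendsto_const_nhds.add (tendsto_const_div_atTop_nhds_zero_nat C)
    have := le_of_tendsto_of_tendsto hentropy hlim hle
    linarith
  -- conclusion
  filter_upwards [hball, measure_eq_zero_iff_ae_notMem.1 hA0] with x hx hxA
  obtain ⟨β, hβ, hb⟩ := hx
  have : ∃ q n0 : ℕ, ∀ M, x ∉ Dio.GS T sym q n0 M := by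
    by_contra hcon
    push Not at hcon
    exact hxA hcon
  obtain ⟨q, n0, hgs⟩ := this
  refine ⟨1 / (2 * β * (q + 2)), by positivity, Real.exp (-(β * (n0 + 2))), Real.exp_pos _, ?_⟩
  intro ρ hρ hρ0 k hk hkε
  have hl : Real.log ρ ≤ -(β * (n0 + 2)) := by
    rw [← Real.log_exp (-(β * (n0 + 2)))]
    exact Real.log_le_log hρ hρ0
  have hneg : Real.log ρ ≤ 0 := hl.trans (by have : 0 ≤ β * (n0 + 2) := by positivity
                                             linarith)
  rw [abs_of_nonpos hneg] at hkε
  set l := -Real.log ρ with hlo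
  have hl2 : (n0 : ℝ) + 2 ≤ l / β := by
    rw [le_div_iff₀ hβ]; linarith
  set n := ⌊l / β⌋₊ with hn
  have hn1 : (n : ℝ) ≤ l / β := Nat.floor_le (le_trans (by positivity) hl2)
  have hn2 : l / β < n + 1 := Nat.lt_floor_add_one _
  have hn0n : n0 ≤ n := by
    apply Nat.le_floor; linarith
  have hkn : k * (q + 2) ≤ n := by
    have h1 : (k : ℝ) * (q + 2) ≤ (l / β) / 2 := by
      calc (k : ℝ) * (q + 2) ≤ 1 / (2 * β * (q + 2)) * l * (q + 2) := by gcongr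
        _ = (l / β) / 2 := by field_simp
    have h2 : (k : ℝ) * (q + 2) ≤ n := by
      have : (0 : ℝ) ≤ n0 := Nat.cast_nonneg _
      linarith
    exact_mod_cast h2
  have hρn : ρ ≤ Real.exp (-β * n) := by
    rw [← Real.exp_log hρ]
    apply Real.exp_le_exp.2
    rw [le_div_iff₀ hβ] at hn1
    linarith
  rw [Set.eq_empty_iff_forall_notMem]
  rintro y ⟨hy1, hy2⟩
  have hsub := (ball_subset_ball hρn).trans (hb n)
  have hz1 : ∀ j < n, sym (T^[j] (T^[k] y)) = sym (T^[j] x) := fun j hj =>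
    (hiff _ _).1 (hsub hy1 j hj _ (hsymP _))
  have hz2 : ∀ j < n, sym (T^[j] y) = sym (T^[j] x) := fun j hj =>
    (hiff _ _).1 (hsub hy2 j hj _ (hsymP _))
  refine hgs n ⟨n, hn0n, le_rfl, k, hk, hkn, fun j hj => ?_⟩
  simp only [zero_add]
  rw [← hz2 (j + k) hj, ← hz1 j (by omega), Function.iterate_add_apply]
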